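/- arXiv:2604.03530 — 2 statements merged into one kernel-verified Lean document; each statement's English description precedes it below -/
import Mathlib

section
/- Let R denote the set of all real numbers q such that Rel(G;q) = 0 for some finite connected simple graph G. Then the topological closure of R in the real numbers is exactly the set [-1,0] ∪ {1}. -/
open SimpleGraph Finset

noncomputable section

/-- The finset of edges of a simple graph on a finite vertex type. -/
def edgeFin {V : Type} [Finite V] (G : SimpleGraph V) : Finset (Sym2 V) :=
  (Set.toFinite G.edgeSet).toFinset

open Classical in
/-- All-terminal reliability polynomial: `relPoly G q` is the probability that the graph stays
connected when every edge fails independently with probability `q`. -/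
def relPoly {V : Type} [Finite V] (G : SimpleGraph V) (q : ℝ) : ℝ :=
  ∑ A ∈ (edgeFin G).powerset,
    if (SimpleGraph.fromEdgeSet (A : Set (Sym2 V))).Connected then
      (1 - q) ^ A.card * q ^ ((edgeFin G).card - A.card) else 0

open Classical in
/-- Split reliability polynomial with terminals `u`, `v`: the sum is over edge subsets whose
spanning subgraph has exactly two components, one containing `u` and the other containing `v`. -/
def splitRel {V : Type} [Finite V] (H : SimpleGraph V) (u v : V) (q : ℝ) : ℝ :=
  ∑ A ∈ (edgeFin H).powerset,
    if (¬ (SimpleGraph.fromEdgeSet (A : Set (Sym2 V))).Reachable u v ∧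
        ∀ w, (SimpleGraph.fromEdgeSet (A : Set (Sym2 V))).Reachable u w ∨
             (SimpleGraph.fromEdgeSet (A : Set (Sym2 V))).Reachable v w) then
      (1 - q) ^ A.card * q ^ ((edgeFin H).card - A.card) else 0

/-- The virtual edge interaction `ŷ_H = Rel(H)/S(H) + 1`. -/
def yhat {V : Type} [Finite V] (H : SimpleGraph V) (u v : V) (q : ℝ) : ℝ :=
  relPoly H q / splitRel H u v q + 1

section Reachability

variable {α : Type*}

/-- Reachability along a finite set of edges. -/
def EdgeReach (A : Finset (Sym2 α)) (x y : α) : Prop :=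
  (SimpleGraph.fromEdgeSet (A : Set (Sym2 α))).Reachable x y

/-- The edge set `A` connects all vertices of `S`. -/
def Spans (S : Finset α) (A : Finset (Sym2 α)) : Prop :=
  ∀ x ∈ S, ∀ y ∈ S, EdgeReach A x y

/-- `A` separates `u` from `v`, and each vertex of `S` is joined to one of them. -/
def Splits (S : Finset α) (u v : α) (A : Finset (Sym2 α)) : Prop :=
  ¬ EdgeReach A u v ∧ ∀ w ∈ S, EdgeReach A u w ∨ EdgeReach A v w

namespace EdgeReach

variable {A B : Finset (Sym2 α)} {x y z : α}

theorem refl (A : Finset (Sym2 α)) (x : α) : EdgeReach A x x := SimpleGraph.Reachable.refl x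

theorem symm (h : EdgeReach A x y) : EdgeReach A y x := SimpleGraph.Reachable.symm h

theorem trans (h : EdgeReach A x y) (h' : EdgeReach A y z) : EdgeReach A x z :=
  SimpleGraph.Reachable.trans h h'

theorem of_mem (h : s(x, y) ∈ A) : EdgeReach A x y := by
  by_cases hxy : x = y
  · exact hxy ▸ refl A x
  · exact SimpleGraph.Adj.reachable (by simp [SimpleGraph.fromEdgeSet_adj, h, hxy])

/-- A property preserved along the edges is preserved along reachability. -/
theorem induct {P : α → Prop} (hP : ∀ a b, s(a, b) ∈ A → P a → P b) (h : EdgeReach A x y)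
    (hx : P x) : P y := by
  have h' := (SimpleGraph.reachable_iff_reflTransGen x y).1 h
  induction h' with
  | refl => exact hx
  | @tail b c hb hbc ih =>
    rw [SimpleGraph.fromEdgeSet_adj] at hbc
    exact hP _ _ (Finset.mem_coe.1 hbc.1)
      (ih ((SimpleGraph.reachable_iff_reflTransGen x b).2 hb))

theorem lift (f : α → α) (hf : ∀ a b, s(a, b) ∈ A → EdgeReach B (f a) (f b))
    (h : EdgeReach A x y) : EdgeReach B (f x) (f y) :=
  h.induct (P := fun w => EdgeReach B (f x) (f w))
    (fun a b hab ha => ha.trans (hf a b hab)) (refl _ _)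

theorem mono (hAB : A ⊆ B) (h : EdgeReach A x y) : EdgeReach B x y :=
  h.lift id fun _ _ hab => of_mem (hAB hab)

end EdgeReach

/-- All edges of `A` have both ends in `S`. -/
def EdgesIn (A : Finset (Sym2 α)) (S : Finset α) : Prop :=
  ∀ a b, s(a, b) ∈ A → a ∈ S ∧ b ∈ S

theorem EdgesIn.mono {A B : Finset (Sym2 α)} {S T : Finset α} (h : EdgesIn A S) (hB : B ⊆ A)
    (hS : S ⊆ T) : EdgesIn B T :=
  fun a b hab => ⟨hS (h a b (hB hab)).1, hS (h a b (hB hab)).2⟩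

variable [DecidableEq α]

section Glue

variable {A₁ A₂ : Finset (Sym2 α)} {S₁ S₂ : Finset α} {x : α}

/-- If two edge sets meet only in the vertex `x`, the second one creates no new connections
inside the first. -/
theorem edgeReach_union_left_iff (h₁ : EdgesIn A₁ S₁) (h₂ : EdgesIn A₂ S₂)
    (hS : S₁ ∩ S₂ ⊆ {x}) {a b : α} (ha : a ∈ S₁) (hb : b ∈ S₁) :
    EdgeReach (A₁ ∪ A₂) a b ↔ EdgeReach A₁ a b := by
  refine ⟨fun h => ?_, fun h => h.mono Finset.subset_union_left⟩
  have key : ∀ z ∈ S₂, (if z ∈ S₁ then z else x) = x := by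
    intro z hz
    split_ifs with h
    · simpa using hS (Finset.mem_inter.2 ⟨h, hz⟩)
    · rfl
  have := h.lift (B := A₁) (fun z => if z ∈ S₁ then z else x) (by
    intro c d hcd
    rcases Finset.mem_union.1 hcd with h | h
    · simpa [(h₁ c d h).1, (h₁ c d h).2] using EdgeReach.of_mem h
    · simp only [key c (h₂ c d h).1, key d (h₂ c d h).2]
      exact EdgeReach.refl _ _)
  simpa [ha, hb] using this

theorem edgeReach_union_right_iff (h₁ : EdgesIn A₁ S₁) (h₂ : EdgesIn A₂ S₂)
    (hS : S₁ ∩ S₂ ⊆ {x}) {a b : α} (ha : a ∈ S₂) (hb : b ∈ S₂) :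
    EdgeReach (A₁ ∪ A₂) a b ↔ EdgeReach A₂ a b := by
  rw [Finset.union_comm]
  exact edgeReach_union_left_iff h₂ h₁ (by rwa [Finset.inter_comm]) ha hb

theorem edgeReach_union_cross_iff (h₁ : EdgesIn A₁ S₁) (h₂ : EdgesIn A₂ S₂)
    (hS : S₁ ∩ S₂ = {x}) {a b : α} (ha : a ∈ S₁) (hb : b ∈ S₂) :
    EdgeReach (A₁ ∪ A₂) a b ↔ EdgeReach A₁ a x ∧ EdgeReach A₂ x b := by
  have hx : x ∈ S₁ ∩ S₂ := by simp [hS]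
  obtain ⟨hx₁, hx₂⟩ := Finset.mem_inter.1 hx
  refine ⟨fun h => ?_, fun h => (h.1.mono Finset.subset_union_left).trans
    (h.2.mono Finset.subset_union_right)⟩
  have hax : EdgeReach (A₁ ∪ A₂) a x := by
    by_cases hb₁ : b ∈ S₁
    · have : b = x := by simpa [hS] using Finset.mem_inter.2 ⟨hb₁, hb⟩
      exact this ▸ h
    by_contra hn
    refine hb₁ (h.induct (P := fun w => EdgeReach (A₁ ∪ A₂) a w ∧ w ∈ S₁) ?_
      ⟨EdgeReach.refl _ _, ha⟩).2
    rintro c d hcd ⟨hc, hcS⟩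
    refine ⟨hc.trans (EdgeReach.of_mem hcd), ?_⟩
    rcases Finset.mem_union.1 hcd with h | h
    · exact (h₁ c d h).2
    · have : c = x := by simpa [hS] using Finset.mem_inter.2 ⟨hcS, (h₂ c d h).1⟩
      exact absurd (this ▸ hc) hn
  exact ⟨(edgeReach_union_left_iff h₁ h₂ hS.le ha hx₁).1 hax,
    (edgeReach_union_right_iff h₁ h₂ hS.le hx₂ hb).1 (hax.symm.trans h)⟩

theorem spans_union_iff (h₁ : EdgesIn A₁ S₁) (h₂ : EdgesIn A₂ S₂) (hS : S₁ ∩ S₂ = {x}) :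
    Spans (S₁ ∪ S₂) (A₁ ∪ A₂) ↔ Spans S₁ A₁ ∧ Spans S₂ A₂ := by
  have hx : x ∈ S₁ ∩ S₂ := by simp [hS]
  obtain ⟨hx₁, hx₂⟩ := Finset.mem_inter.1 hx
  constructor
  · refine fun h => ⟨fun a ha b hb => ?_, fun a ha b hb => ?_⟩
    · exact (edgeReach_union_left_iff h₁ h₂ hS.le ha hb).1
        (h a (Finset.mem_union_left _ ha) b (Finset.mem_union_left _ hb))
    · exact (edgeReach_union_right_iff h₁ h₂ hS.le ha hb).1
        (h a (Finset.mem_union_right _ ha) b (Finset.mem_union_right _ hb))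
  · rintro ⟨k₁, k₂⟩
    have hall : ∀ a ∈ S₁ ∪ S₂, EdgeReach (A₁ ∪ A₂) a x := by
      intro a ha
      rcases Finset.mem_union.1 ha with h | h
      · exact (k₁ a h x hx₁).mono Finset.subset_union_left
      · exact (k₂ a h x hx₂).mono Finset.subset_union_right
    exact fun a ha b hb => (hall a ha).trans (hall b hb).symm

theorem splits_union_iff (h₁ : EdgesIn A₁ S₁) (h₂ : EdgesIn A₂ S₂) (hS : S₁ ∩ S₂ = {x})
    {u v : α} (hu : u ∈ S₁) (hv : v ∈ S₂) :
    Splits (S₁ ∪ S₂) u v (A₁ ∪ A₂) ↔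
      (Splits S₁ u x A₁ ∧ Spans S₂ A₂) ∨ (Spans S₁ A₁ ∧ Splits S₂ x v A₂) := by
  have hx : x ∈ S₁ ∩ S₂ := by simp [hS]
  obtain ⟨hx₁, hx₂⟩ := Finset.mem_inter.1 hx
  have hcross {a b : α} (ha : a ∈ S₁) (hb : b ∈ S₂) := edgeReach_union_cross_iff h₁ h₂ hS ha hb
  have hleft {a b : α} (ha : a ∈ S₁) (hb : b ∈ S₁) := edgeReach_union_left_iff h₁ h₂ hS.le ha hb
  have hright {a b : α} (ha : a ∈ S₂) (hb : b ∈ S₂) := edgeReach_union_right_iff h₁ h₂ hS.le ha hb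
  have hsymm {a b : α} : EdgeReach (A₁ ∪ A₂) a b ↔ EdgeReach (A₁ ∪ A₂) b a :=
    ⟨EdgeReach.symm, EdgeReach.symm⟩
  constructor
  · rintro ⟨hn, hall⟩
    rw [hcross hu hv] at hn
    by_cases hux : EdgeReach A₁ u x
    · have hxv : ¬ EdgeReach A₂ x v := fun h => hn ⟨hux, h⟩
      refine Or.inr ⟨?_, hxv, fun w hw => ?_⟩
      · have : ∀ w ∈ S₁, EdgeReach A₁ u w := by
          intro w hw
          rcases hall w (Finset.mem_union_left _ hw) with h | h
          · exact (hleft hu hw).1 h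
          · rw [hsymm, hcross hw hv] at h
            exact absurd h.2 hxv
        exact fun a ha b hb => (this a ha).symm.trans (this b hb)
      · rcases hall w (Finset.mem_union_right _ hw) with h | h
        · exact Or.inl ((hcross hu hw).1 h).2
        · exact Or.inr ((hright hv hw).1 h)
    · have hxv : EdgeReach A₂ x v := by
        rcases hall x (Finset.mem_union_left _ hx₁) with h | h
        · exact absurd ((hleft hu hx₁).1 h) hux
        · exact ((hright hv hx₂).1 h).symm
      refine Or.inl ⟨⟨hux, fun w hw => ?_⟩, ?_⟩
      · rcases hall w (Finset.mem_union_left _ hw) with h | h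
        · exact Or.inl ((hleft hu hw).1 h)
        · rw [hsymm, hcross hw hv] at h
          exact Or.inr h.1.symm
      · have : ∀ w ∈ S₂, EdgeReach A₂ v w := by
          intro w hw
          rcases hall w (Finset.mem_union_right _ hw) with h | h
          · exact absurd ((hcross hu hw).1 h).1 hux
          · exact (hright hv hw).1 h
        exact fun a ha b hb => (this a ha).symm.trans (this b hb)
  · rintro (⟨⟨hn, hall⟩, k₂⟩ | ⟨k₁, hn, hall⟩)
    · refine ⟨fun h => hn ((hcross hu hv).1 h).1, fun w hw => ?_⟩
      rcases Finset.mem_union.1 hw with h | h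
      · rcases hall w h with h' | h'
        · exact Or.inl ((hleft hu h).2 h')
        · exact Or.inr (hsymm.1 ((hcross h hv).2 ⟨h'.symm, k₂ x hx₂ v hv⟩))
      · exact Or.inr ((hright hv h).2 (k₂ v hv w h))
    · refine ⟨fun h => hn ((hcross hu hv).1 h).2, fun w hw => ?_⟩
      rcases Finset.mem_union.1 hw with h | h
      · exact Or.inl ((hleft hu h).2 (k₁ u hu w h))
      · rcases hall w h with h' | h'
        · exact Or.inl ((hcross hu h).2 ⟨k₁ u hu x hx₁, h'⟩)
        · exact Or.inr ((hright hv h).2 h')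

end Glue

/-- Adding the edge `uv` connects exactly the edge sets which connect everything already or split
between `u` and `v`. -/
theorem spans_insert_iff {S : Finset α} {A : Finset (Sym2 α)} {u v : α} (hu : u ∈ S)
    (hv : v ∈ S) : Spans S (insert s(u, v) A) ↔ Spans S A ∨ Splits S u v A := by
  have hsub : A ⊆ insert s(u, v) A := Finset.subset_insert _ _
  have huv : EdgeReach (insert s(u, v) A) u v := EdgeReach.of_mem (Finset.mem_insert_self _ _)
  constructor
  · intro h
    have hall : ∀ w ∈ S, EdgeReach A u w ∨ EdgeReach A v w := by
      intro w hw
      refine (h u hu w hw).induct (P := fun w => EdgeReach A u w ∨ EdgeReach A v w) ?_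
        (Or.inl (EdgeReach.refl _ _))
      intro a b hab ha
      rcases Finset.mem_insert.1 hab with h | h
      · rcases Sym2.eq_iff.1 h with ⟨rfl, rfl⟩ | ⟨rfl, rfl⟩
        · exact Or.inr (EdgeReach.refl _ _)
        · exact Or.inl (EdgeReach.refl _ _)
      · exact ha.imp (fun k => k.trans (EdgeReach.of_mem h)) fun k => k.trans (EdgeReach.of_mem h)
    by_cases k : EdgeReach A u v
    · have : ∀ w ∈ S, EdgeReach A u w := fun w hw => (hall w hw).elim id k.trans
      exact Or.inl fun a ha b hb => (this a ha).symm.trans (this b hb)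
    · exact Or.inr ⟨k, hall⟩
  · rintro (h | ⟨-, h⟩)
    · exact fun a ha b hb => (h a ha b hb).mono hsub
    · have : ∀ w ∈ S, EdgeReach (insert s(u, v) A) u w := fun w hw =>
        (h w hw).elim (fun k => k.mono hsub) fun k => huv.trans (k.mono hsub)
      exact fun a ha b hb => (this a ha).symm.trans (this b hb)

end Reachability

section EdgeSums

variable {α : Type*} [DecidableEq α] {v : ℝ} {F F₁ F₂ : Finset (Sym2 α)}

theorem union_inter_of_disjoint {β : Type*} [DecidableEq β] {s t A B : Finset β}
    (hst : Disjoint s t) (hA : A ⊆ s) (hB : B ⊆ t) : (A ∪ B) ∩ s = A ∧ (A ∪ B) ∩ t = B := by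
  rw [Finset.disjoint_left] at hst
  constructor <;> ext x <;> have := @hst x <;> have := @hA x <;> have := @hB x <;>
    simp only [Finset.mem_inter, Finset.mem_union] <;> tauto

theorem sum_powerset_union_of_disjoint {β : Type*} [DecidableEq β] {s t : Finset β}
    (hst : Disjoint s t) (f : Finset β → ℝ) :
    ∑ A ∈ (s ∪ t).powerset, f A = ∑ A ∈ s.powerset, ∑ B ∈ t.powerset, f (A ∪ B) := by
  rw [← Finset.sum_product']
  refine Finset.sum_bij' (fun A _ => (A ∩ s, A ∩ t)) (fun x _ => x.1 ∪ x.2) ?_ ?_ ?_ ?_ ?_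
  · intro A _
    simp [Finset.inter_subset_right]
  · rintro ⟨A, B⟩ h
    simp only [Finset.mem_product, Finset.mem_powerset] at h ⊢
    exact Finset.union_subset_union h.1 h.2
  · intro A hA
    simp only [Finset.mem_powerset] at hA
    rw [← Finset.inter_union_distrib_left, Finset.inter_eq_left.2 hA]
  · rintro ⟨A, B⟩ h
    simp only [Finset.mem_product, Finset.mem_powerset] at h
    exact Prod.ext_iff.2 (union_inter_of_disjoint hst h.1 h.2)
  · intro A hA
    simp only [Finset.mem_powerset] at hA
    rw [← Finset.inter_union_distrib_left, Finset.inter_eq_left.2 hA]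

open Classical in
/-- The sum of `v ^ |A|` over the subsets `A` of `F` with the property `P`. -/
def edgeSum (v : ℝ) (F : Finset (Sym2 α)) (P : Finset (Sym2 α) → Prop) : ℝ :=
  ∑ A ∈ F.powerset, if P A then v ^ A.card else 0

omit [DecidableEq α] in
theorem edgeSum_congr {P Q : Finset (Sym2 α) → Prop} (h : ∀ A ⊆ F, P A ↔ Q A) :
    edgeSum v F P = edgeSum v F Q := by
  rw [edgeSum, edgeSum]
  refine Finset.sum_congr rfl fun A hA => ?_
  rw [propext (h A (Finset.mem_powerset.1 hA))]

omit [DecidableEq α] in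
theorem edgeSum_false : edgeSum v F (fun _ => False) = 0 := by simp [edgeSum]

omit [DecidableEq α] in
theorem edgeSum_true : edgeSum v F (fun _ => True) = (1 + v) ^ F.card := by
  rw [add_comm, ← Finset.sum_pow_mul_eq_add_pow]
  simp [edgeSum]

omit [DecidableEq α] in
theorem edgeSum_or {P Q : Finset (Sym2 α) → Prop} (h : ∀ A ⊆ F, P A → ¬ Q A) :
    edgeSum v F (fun A => P A ∨ Q A) = edgeSum v F P + edgeSum v F Q := by
  rw [edgeSum, edgeSum, edgeSum, ← Finset.sum_add_distrib]
  refine Finset.sum_congr rfl fun A hA => ?_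
  have := h A (Finset.mem_powerset.1 hA)
  by_cases hP : P A <;> by_cases hQ : Q A <;> simp_all

theorem edgeSum_union (hF : Disjoint F₁ F₂) {P P₁ P₂ : Finset (Sym2 α) → Prop}
    (h : ∀ A₁ ⊆ F₁, ∀ A₂ ⊆ F₂, P (A₁ ∪ A₂) ↔ P₁ A₁ ∧ P₂ A₂) :
    edgeSum v (F₁ ∪ F₂) P = edgeSum v F₁ P₁ * edgeSum v F₂ P₂ := by
  rw [edgeSum, sum_powerset_union_of_disjoint hF, edgeSum, edgeSum, Finset.sum_mul_sum]
  refine Finset.sum_congr rfl fun A hA => Finset.sum_congr rfl fun B hB => ?_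
  rw [Finset.mem_powerset] at hA hB
  rw [Finset.card_union_of_disjoint (hF.mono hA hB), pow_add]
  by_cases h₁ : P₁ A <;> by_cases h₂ : P₂ B <;> simp [h A hA B hB, h₁, h₂]

/-- The edges of the complete graph on `S`. -/
def cliqueEdges (S : Finset α) : Finset (Sym2 α) := S.offDiag.image Sym2.mk.uncurry

theorem mk_mem_cliqueEdges {S : Finset α} {a b : α} :
    s(a, b) ∈ cliqueEdges S ↔ a ∈ S ∧ b ∈ S ∧ a ≠ b := by
  simp only [cliqueEdges, Finset.mem_image, Prod.exists, Finset.mem_offDiag,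
    Function.uncurry_apply_pair, Sym2.eq_iff]
  constructor
  · rintro ⟨c, d, ⟨hc, hd, hcd⟩, ⟨rfl, rfl⟩ | ⟨rfl, rfl⟩⟩
    · exact ⟨hc, hd, hcd⟩
    · exact ⟨hd, hc, hcd.symm⟩
  · exact fun h => ⟨a, b, h, Or.inl ⟨rfl, rfl⟩⟩

theorem card_cliqueEdges (S : Finset α) : (cliqueEdges S).card = S.card.choose 2 :=
  Sym2.card_image_offDiag S

theorem edgesIn_cliqueEdges (S : Finset α) : EdgesIn (cliqueEdges S) S :=
  fun _ _ h => ⟨(mk_mem_cliqueEdges.1 h).1, (mk_mem_cliqueEdges.1 h).2.1⟩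

theorem cliqueEdges_mono {S T : Finset α} (h : S ⊆ T) : cliqueEdges S ⊆ cliqueEdges T := by
  intro e
  induction e with
  | _ a b =>
    simp only [mk_mem_cliqueEdges]
    exact fun k => ⟨h k.1, h k.2.1, k.2.2⟩

theorem disjoint_cliqueEdges {S T : Finset α} {x : α} (h : S ∩ T ⊆ {x}) :
    Disjoint (cliqueEdges S) (cliqueEdges T) := by
  rw [Finset.disjoint_left]
  intro e
  induction e with
  | _ a b =>
    simp only [mk_mem_cliqueEdges]
    rintro ⟨ha, hb, hab⟩ ⟨ha', hb', -⟩
    have h₁ : a = x := by simpa using h (Finset.mem_inter.2 ⟨ha, ha'⟩)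
    have h₂ : b = x := by simpa using h (Finset.mem_inter.2 ⟨hb, hb'⟩)
    exact hab (h₁.trans h₂.symm)

open Classical in
/-- Sorting the edge sets of a complete graph by the component of a vertex `u`. -/
theorem edgeSum_cliqueEdges_eq_sum_component {S : Finset α} {u : α} (hu : u ∈ S)
    {P : Finset (Sym2 α) → Prop} {Q : Finset α → Finset (Sym2 α) → Prop}
    (hPQ : ∀ B ⊆ S, u ∈ B → ∀ A₁ ⊆ cliqueEdges B, Spans B A₁ → ∀ A₂ ⊆ cliqueEdges (S \ B),
      (P (A₁ ∪ A₂) ↔ Q B A₂)) :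
    edgeSum v (cliqueEdges S) P = ∑ B ∈ S.powerset with u ∈ B,
      edgeSum v (cliqueEdges B) (Spans B) * edgeSum v (cliqueEdges (S \ B)) (Q B) := by
  rw [edgeSum, ← Finset.sum_fiberwise_of_maps_to (g := fun A => S.filter (EdgeReach A u))
    (t := S.powerset.filter (u ∈ ·))]
  swap
  · intro A _
    simp [hu, EdgeReach.refl]
  refine Finset.sum_congr rfl fun B hB => ?_
  obtain ⟨hBS, huB⟩ := Finset.mem_filter.1 hB
  rw [Finset.mem_powerset] at hBS
  have hdisj : Disjoint (cliqueEdges B) (cliqueEdges (S \ B)) :=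
    disjoint_cliqueEdges (x := u) (by simp)
  rw [← edgeSum_union hdisj (P := fun A => Spans B (A ∩ cliqueEdges B) ∧
    Q B (A ∩ cliqueEdges (S \ B)))]
  swap
  · intro A₁ h₁ A₂ h₂
    obtain ⟨e₁, e₂⟩ := union_inter_of_disjoint hdisj h₁ h₂
    rw [e₁, e₂]
  have hfilter : (cliqueEdges S).powerset.filter (fun A => S.filter (EdgeReach A u) = B) =
      (cliqueEdges B ∪ cliqueEdges (S \ B)).powerset.filter
        (fun A => Spans B (A ∩ cliqueEdges B)) := by
    ext A
    simp only [Finset.mem_filter, Finset.mem_powerset]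
    constructor
    · rintro ⟨hA, rfl⟩
      have hstep : ∀ a b, s(a, b) ∈ A → EdgeReach A u a →
          s(a, b) ∈ A ∩ cliqueEdges (S.filter (EdgeReach A u)) := by
        intro a b hab ha
        have h := mk_mem_cliqueEdges.1 (hA hab)
        simp only [Finset.mem_inter, mk_mem_cliqueEdges, Finset.mem_filter]
        exact ⟨hab, ⟨h.1, ha⟩, ⟨h.2.1, ha.trans (EdgeReach.of_mem hab)⟩, h.2.2⟩
      constructor
      · intro e
        induction e with
        | _ a b =>
          intro hab
          by_cases ha : EdgeReach A u a
          · exact Finset.mem_union_left _ (Finset.mem_inter.1 (hstep a b hab ha)).2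
          · have hb : ¬ EdgeReach A u b := fun h => ha (h.trans (EdgeReach.of_mem hab).symm)
            have h := mk_mem_cliqueEdges.1 (hA hab)
            refine Finset.mem_union_right _ (mk_mem_cliqueEdges.2 ⟨?_, ?_, h.2.2⟩) <;>
              simp [h.1, h.2.1, ha, hb]
      · have hall : ∀ y, EdgeReach A u y →
            EdgeReach (A ∩ cliqueEdges (S.filter (EdgeReach A u))) u y := by
          intro y hy
          refine (hy.induct (P := fun w => EdgeReach A u w ∧
            EdgeReach (A ∩ cliqueEdges (S.filter (EdgeReach A u))) u w) ?_
            ⟨EdgeReach.refl _ _, EdgeReach.refl _ _⟩).2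
          rintro a b hab ⟨ha, ha'⟩
          exact ⟨ha.trans (EdgeReach.of_mem hab), ha'.trans (EdgeReach.of_mem (hstep a b hab ha))⟩
        intro a ha b hb
        exact (hall a (Finset.mem_filter.1 ha).2).symm.trans (hall b (Finset.mem_filter.1 hb).2)
    · rintro ⟨hA, hspan⟩
      refine ⟨hA.trans (Finset.union_subset (cliqueEdges_mono hBS)
        (cliqueEdges_mono Finset.sdiff_subset)), ?_⟩
      ext y
      simp only [Finset.mem_filter]
      constructor
      · rintro ⟨-, hy⟩
        refine hy.induct (P := (· ∈ B)) ?_ huB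
        intro a b hab ha
        rcases Finset.mem_union.1 (hA hab) with h | h
        · exact (mk_mem_cliqueEdges.1 h).2.1
        · exact absurd ha (Finset.mem_sdiff.1 (mk_mem_cliqueEdges.1 h).1).2
      · exact fun hy => ⟨hBS hy, (hspan u huB y hy).mono Finset.inter_subset_left⟩
  rw [hfilter, Finset.sum_filter, edgeSum]
  refine Finset.sum_congr rfl fun A hA => ?_
  rw [Finset.mem_powerset] at hA
  by_cases hspan : Spans B (A ∩ cliqueEdges B)
  · have hAeq : A ∩ cliqueEdges B ∪ A ∩ cliqueEdges (S \ B) = A := by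
      rw [← Finset.inter_union_distrib_left, Finset.inter_eq_left.2 hA]
    have := hPQ B hBS huB _ Finset.inter_subset_right hspan (A ∩ cliqueEdges (S \ B))
      Finset.inter_subset_right
    rw [hAeq] at this
    simp [hspan, this]
  · simp [hspan]

/-- The component sum with `P` trivial. -/
theorem pow_card_cliqueEdges_eq_sum {S : Finset α} {u : α} (hu : u ∈ S) :
    (1 + v) ^ (cliqueEdges S).card = ∑ B ∈ S.powerset with u ∈ B,
      edgeSum v (cliqueEdges B) (Spans B) * (1 + v) ^ (cliqueEdges (S \ B)).card := by
  simp only [← edgeSum_true]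
  exact edgeSum_cliqueEdges_eq_sum_component hu fun _ _ _ _ _ _ _ _ => Iff.rfl

theorem edgeSum_splits_cliqueEdges {S : Finset α} {u w : α} (hu : u ∈ S) (hw : w ∈ S) :
    edgeSum v (cliqueEdges S) (Splits S u w) = ∑ B ∈ S.powerset with u ∈ B,
      edgeSum v (cliqueEdges B) (Spans B) *
        edgeSum v (cliqueEdges (S \ B)) (fun A => w ∉ B ∧ Spans (S \ B) A) := by
  refine edgeSum_cliqueEdges_eq_sum_component hu fun B hBS huB A₁ h₁ hspan A₂ h₂ => ?_
  have hin : ∀ {a b}, a ∈ B → EdgeReach (A₁ ∪ A₂) a b → b ∈ B := by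
    intro a b ha h
    refine h.induct (P := (· ∈ B)) ?_ ha
    intro c d hcd hc
    rcases Finset.mem_union.1 hcd with h | h
    · exact (mk_mem_cliqueEdges.1 (h₁ h)).2.1
    · exact absurd hc (Finset.mem_sdiff.1 (mk_mem_cliqueEdges.1 (h₂ h)).1).2
  have hout : ∀ {a b}, a ∉ B → EdgeReach (A₁ ∪ A₂) a b → EdgeReach A₂ a b := by
    intro a b ha h
    refine (h.induct (P := fun z => z ∉ B ∧ EdgeReach A₂ a z) ?_ ⟨ha, EdgeReach.refl _ _⟩).2
    rintro c d hcd ⟨hc, hac⟩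
    rcases Finset.mem_union.1 hcd with h | h
    · exact absurd (mk_mem_cliqueEdges.1 (h₁ h)).1 hc
    · exact ⟨(Finset.mem_sdiff.1 (mk_mem_cliqueEdges.1 (h₂ h)).2.1).2,
        hac.trans (EdgeReach.of_mem h)⟩
  constructor
  · rintro ⟨hn, hall⟩
    have hwB : w ∉ B := fun h => hn ((hspan u huB w h).mono Finset.subset_union_left)
    have hreach : ∀ z ∈ S \ B, EdgeReach A₂ w z := by
      intro z hz
      obtain ⟨hzS, hzB⟩ := Finset.mem_sdiff.1 hz
      rcases hall z hzS with h | h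
      · exact absurd (hin huB h) hzB
      · exact hout hwB h
    exact ⟨hwB, fun a ha b hb => (hreach a ha).symm.trans (hreach b hb)⟩
  · rintro ⟨hwB, h⟩
    refine ⟨fun k => hwB (hin huB k), fun z hz => ?_⟩
    by_cases hzB : z ∈ B
    · exact Or.inl ((hspan u huB z hzB).mono Finset.subset_union_left)
    · exact Or.inr ((h w (Finset.mem_sdiff.2 ⟨hw, hwB⟩) z
        (Finset.mem_sdiff.2 ⟨hz, hzB⟩)).mono Finset.subset_union_right)

end EdgeSums

section CliqueReliability

/-- The all-terminal reliability of the complete graph on `m + 1` vertices. -/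
def cliqueRel (q : ℝ) (m : ℕ) : ℝ :=
  1 - ∑ j : Fin m, (m.choose j : ℝ) * (cliqueRel q j * q ^ ((j + 1 : ℕ) * (m - j)))
termination_by m
decreasing_by exact j.2

/-- The split reliability of the complete graph on `m + 2` vertices, divided by `q ^ (m + 1)`. -/
def cliqueSplit (q : ℝ) (m : ℕ) : ℝ :=
  ∑ j ∈ Finset.range (m + 1),
    (m.choose j : ℝ) * (cliqueRel q j * cliqueRel q (m - j) * q ^ (j * (m - j)))

theorem cliqueRel_eq (q : ℝ) (m : ℕ) : cliqueRel q m =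
    1 - ∑ j ∈ Finset.range m, (m.choose j : ℝ) * (cliqueRel q j * q ^ ((j + 1) * (m - j))) := by
  rw [cliqueRel, ← Fin.sum_univ_eq_sum_range
    (fun j => (m.choose j : ℝ) * (cliqueRel q j * q ^ ((j + 1) * (m - j)))) m]

theorem choose_two_add (k l : ℕ) : (k + l).choose 2 = k.choose 2 + l.choose 2 + k * l := by
  induction l with
  | zero => simp
  | succ l ih =>
    rw [← add_assoc, Nat.choose_succ_succ' (k + l) 1, Nat.choose_succ_succ' l 1, ih]
    simp only [Nat.choose_one_right]
    ring

variable {α : Type*} [DecidableEq α]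

theorem sum_powerset_filter_mem {S : Finset α} {u : α} (hu : u ∈ S) (f : Finset α → ℝ) :
    ∑ B ∈ S.powerset with u ∈ B, f B = ∑ B ∈ (S.erase u).powerset, f (insert u B) := by
  refine Finset.sum_bij' (fun B _ => B.erase u) (fun B _ => insert u B) ?_ ?_ ?_ ?_ ?_
  · intro B hB
    simp only [Finset.mem_filter, Finset.mem_powerset] at hB ⊢
    exact Finset.erase_subset_erase _ hB.1
  · intro B hB
    simp only [Finset.mem_filter, Finset.mem_powerset] at hB ⊢
    exact ⟨Finset.insert_subset hu (hB.trans (Finset.erase_subset _ _)),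
      Finset.mem_insert_self _ _⟩
  · intro B hB
    exact Finset.insert_erase (Finset.mem_filter.1 hB).2
  · intro B hB
    exact Finset.erase_insert fun h => by simpa using Finset.mem_powerset.1 hB h
  · intro B hB
    rw [Finset.insert_erase (Finset.mem_filter.1 hB).2]

theorem card_insert_of_subset_erase {S B : Finset α} {u : α} {m : ℕ} (hu : u ∈ S)
    (hS : S.card = m + 1) (hB : B ⊆ S.erase u) :
    (insert u B).card = B.card + 1 ∧ (S \ insert u B).card = m - B.card ∧ B.card ≤ m := by
  have huB : u ∉ B := fun h => by simpa using hB h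
  have h₁ : (insert u B).card = B.card + 1 := Finset.card_insert_of_notMem huB
  have hsub : insert u B ⊆ S := Finset.insert_subset hu (hB.trans (Finset.erase_subset _ _))
  have h₂ := Finset.card_sdiff_of_subset hsub
  have h₃ := Finset.card_le_card hsub
  omega

variable {q : ℝ}

theorem edgeSum_spans_cliqueEdges (hq : q ≠ 0) (m : ℕ) (S : Finset α) (hS : S.card = m + 1) :
    q ^ (m + 1).choose 2 * edgeSum (q⁻¹ - 1) (cliqueEdges S) (Spans S) = cliqueRel q m := by
  induction m using Nat.strong_induction_on generalizing S with
  | _ m ih =>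
  obtain ⟨u, hu⟩ : S.Nonempty := Finset.card_pos.1 (by omega)
  set t := q ^ (m + 1).choose 2 * edgeSum (q⁻¹ - 1) (cliqueEdges S) (Spans S) with ht
  have key := pow_card_cliqueEdges_eq_sum (v := q⁻¹ - 1) hu
  rw [sum_powerset_filter_mem hu, card_cliqueEdges, hS, add_sub_cancel, inv_pow] at key
  have h₁ : (1 : ℝ) = ∑ B ∈ (S.erase u).powerset, q ^ (m + 1).choose 2 *
      (edgeSum (q⁻¹ - 1) (cliqueEdges (insert u B)) (Spans (insert u B)) *
        (q⁻¹) ^ (cliqueEdges (S \ insert u B)).card) := by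
    rw [← Finset.mul_sum, ← key, mul_inv_cancel₀ (pow_ne_zero _ hq)]
  obtain ⟨g, hg⟩ : ∃ g : ℕ → ℝ, ∀ j,
      g j = if j < m then cliqueRel q j * q ^ ((j + 1) * (m - j)) else t := ⟨_, fun _ => rfl⟩
  have h₂ : (1 : ℝ) = ∑ B ∈ (S.erase u).powerset, g B.card := by
    refine h₁.trans (Finset.sum_congr rfl fun B hB => ?_)
    rw [Finset.mem_powerset] at hB
    obtain ⟨k₁, k₂, k₃⟩ := card_insert_of_subset_erase hu hS hB
    rw [card_cliqueEdges, k₂]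
    rw [hg]
    split_ifs with hlt
    · rw [← ih _ hlt _ k₁]
      have : (m + 1).choose 2 = (B.card + 1).choose 2 + (m - B.card).choose 2
          + (B.card + 1) * (m - B.card) := by
        rw [← choose_two_add]
        congr 1
        omega
      rw [this, pow_add, pow_add, inv_pow]
      field_simp
    · have hBm : B.card = m := by omega
      have hBS : insert u B = S := Finset.eq_of_subset_of_card_le
        (Finset.insert_subset hu (hB.trans (Finset.erase_subset _ _))) (by omega)
      simp [hBm, hBS, ht]
  rw [Finset.sum_powerset_apply_card, Finset.card_erase_of_mem hu, hS, Nat.add_sub_cancel,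
    Finset.sum_range_succ] at h₂
  simp only [hg, Nat.choose_self, lt_irrefl, if_false, one_smul, nsmul_eq_mul] at h₂
  rw [Finset.sum_congr rfl fun j hj => by rw [if_pos (Finset.mem_range.1 hj)]] at h₂
  rw [cliqueRel_eq]
  linarith

theorem edgeSum_splits_cliqueEdges_eq (hq : q ≠ 0) (m : ℕ) (S : Finset α) (hS : S.card = m + 2)
    {u w : α} (hu : u ∈ S) (hw : w ∈ S) (huw : u ≠ w) :
    q ^ (m + 2).choose 2 * edgeSum (q⁻¹ - 1) (cliqueEdges S) (Splits S u w) =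
      q ^ (m + 1) * cliqueSplit q m := by
  have hw' : w ∈ S.erase u := Finset.mem_erase.2 ⟨huw.symm, hw⟩
  have hcard : ((S.erase u).erase w).card = m := by
    rw [Finset.card_erase_of_mem hw', Finset.card_erase_of_mem hu, hS]
    rfl
  rw [edgeSum_splits_cliqueEdges hu hw, sum_powerset_filter_mem hu,
    ← Finset.sum_subset (Finset.powerset_mono.2 (Finset.erase_subset w (S.erase u)))]
  swap
  · intro B hB hB'
    have hwB : w ∈ B := by
      by_contra h
      exact hB' (Finset.mem_powerset.2 fun x hx => Finset.mem_erase.2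
        ⟨fun hxw => h (hxw ▸ hx), Finset.mem_powerset.1 hB hx⟩)
    simp [hwB, edgeSum_false]
  rw [Finset.mul_sum, cliqueSplit, ← hcard]
  simp only [← nsmul_eq_mul]
  rw [← Finset.sum_powerset_apply_card (fun j =>
    cliqueRel q j * cliqueRel q (((S.erase u).erase w).card - j)
      * q ^ (j * (((S.erase u).erase w).card - j))), Finset.mul_sum, hcard]
  refine Finset.sum_congr rfl fun B hB => ?_
  rw [Finset.mem_powerset] at hB
  have hBm : B.card ≤ m := hcard ▸ Finset.card_le_card hB
  obtain ⟨k₁, k₂, -⟩ := card_insert_of_subset_erase hu hS (hB.trans (Finset.erase_subset _ _))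
  have hwB : w ∉ insert u B := by
    simp only [Finset.mem_insert, not_or]
    exact ⟨huw.symm, fun h => by simpa using hB h⟩
  simp only [hwB, not_false_eq_true, true_and]
  rw [← edgeSum_spans_cliqueEdges hq _ _ k₁,
    ← edgeSum_spans_cliqueEdges hq (m - B.card) (S \ insert u B) (by omega)]
  obtain ⟨l, rfl⟩ := Nat.exists_eq_add_of_le hBm
  have : (B.card + l + 2).choose 2 = (B.card + 1).choose 2 + (l + 1).choose 2
      + (B.card * l + (B.card + l + 1)) := by
    rw [show B.card + l + 2 = (B.card + 1) + (l + 1) by ring, choose_two_add]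
    ring
  rw [this, pow_add, pow_add, pow_add, Nat.add_sub_cancel_left]
  ring

end CliqueReliability

section CliqueAsymptotics

open Filter Topology

theorem tendsto_sum_choose_mul_pow {s : ℝ} (hs₀ : 0 ≤ s) (hs₁ : s < 1) :
    Tendsto (fun m : ℕ => ∑ j ∈ Finset.range m,
      ((m + 1).choose (j + 1) : ℝ) * s ^ ((j + 1) * (m - j))) atTop (𝓝 0) := by
  set t := √s with ht
  have ht₀ : 0 ≤ t := Real.sqrt_nonneg s
  have ht₁ : t < 1 := by rw [ht, Real.sqrt_lt' one_pos]; simpa using hs₁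
  have hts : t ^ 2 = s := Real.sq_sqrt hs₀
  have hupper : Tendsto (fun m : ℕ => 2 * (Real.exp (((m + 1 : ℕ) : ℝ) * t ^ (m + 1)) - 1))
      atTop (𝓝 0) := by
    have h := (tendsto_self_mul_const_pow_of_lt_one ht₀ ht₁).comp (tendsto_add_atTop_nat 1)
    have h' := (((Real.continuous_exp.tendsto 0).comp h).sub_const 1).const_mul 2
    simpa using h'
  refine squeeze_zero (fun m => by positivity) (fun m => ?_) hupper
  set x := t ^ (m + 1) with hx
  have hx₀ : 0 ≤ x := by positivity
  have hterm : ∀ j ∈ Finset.range m, ((m + 1).choose (j + 1) : ℝ) * s ^ ((j + 1) * (m - j)) ≤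
      ((m + 1).choose (j + 1) : ℝ) * x ^ (j + 1) +
        ((m + 1).choose (j + 1) : ℝ) * x ^ (m - j) := by
    intro j hj
    have hjm := Finset.mem_range.1 hj
    obtain ⟨l, rfl⟩ := Nat.exists_eq_add_of_le hjm.le
    rw [← mul_add]
    refine mul_le_mul_of_nonneg_left ?_ (by positivity)
    rw [Nat.add_sub_cancel_left, ← hts, hx, ← pow_mul, ← pow_mul, ← pow_mul]
    rcases le_total (j + 1) l with h | h
    · refine le_add_of_le_of_nonneg (pow_le_pow_of_le_one ht₀ ht₁.le ?_) (by positivity)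
      nlinarith
    · refine le_add_of_nonneg_of_le (by positivity) (pow_le_pow_of_le_one ht₀ ht₁.le ?_)
      nlinarith
  have hbinom : (1 + x) ^ (m + 1) ≤ Real.exp (((m + 1 : ℕ) : ℝ) * x) := by
    rw [Real.exp_nat_mul]
    refine pow_le_pow_left₀ (by positivity) ?_ _
    linarith [Real.add_one_le_exp x]
  have h₁ : ∑ j ∈ Finset.range m, ((m + 1).choose (j + 1) : ℝ) * x ^ (j + 1) ≤
      (1 + x) ^ (m + 1) - 1 := by
    have := add_pow x 1 (m + 1)
    rw [Finset.sum_range_succ', Finset.sum_range_succ] at this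
    simp only [one_pow, mul_one, pow_zero, Nat.choose_zero_right, Nat.cast_one,
      Nat.choose_self] at this
    rw [add_comm 1 x, this]
    simp only [mul_comm (x ^ _)]
    have : 0 ≤ x ^ (m + 1) := by positivity
    linarith
  have h₂ : ∑ j ∈ Finset.range m, ((m + 1).choose (j + 1) : ℝ) * x ^ (m - j) ≤
      (1 + x) ^ (m + 1) - 1 := by
    have := add_pow 1 x (m + 1)
    rw [Finset.sum_range_succ', Finset.sum_range_succ] at this
    simp only [one_pow, one_mul, Nat.choose_zero_right, Nat.cast_one,
      Nat.choose_self, Nat.add_sub_add_right, Nat.sub_self, pow_zero, mul_one, Nat.sub_zero]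
      at this
    rw [this]
    simp only [mul_comm (x ^ _)]
    have : 0 ≤ x ^ (m + 1) := by positivity
    linarith
  calc _ ≤ _ := Finset.sum_le_sum hterm
    _ ≤ 2 * (Real.exp (((m + 1 : ℕ) : ℝ) * x) - 1) := by
      rw [Finset.sum_add_distrib]
      linarith

variable {q : ℝ}

theorem abs_cliqueRel_sub_one_le {M : ℝ} {m : ℕ} (hM : ∀ j ≤ m, |cliqueRel q j| ≤ M) :
    |cliqueRel q (m + 1) - 1| ≤ M * (|q| ^ (m + 1) + ∑ j ∈ Finset.range m,
      ((m + 1).choose (j + 1) : ℝ) * (|q| ^ ((j + 2) * (m - j)))) := by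
  rw [cliqueRel_eq, sub_sub_cancel_left, abs_neg]
  refine (Finset.abs_sum_le_sum_abs _ _).trans ?_
  rw [Finset.sum_range_succ', mul_add, add_comm (M * _), Finset.mul_sum]
  refine add_le_add (Finset.sum_le_sum fun j hj => ?_) ?_
  · have hj := Finset.mem_range.1 hj
    rw [abs_mul, abs_mul, abs_pow, Nat.abs_cast, Nat.add_sub_add_right, mul_left_comm]
    exact mul_le_mul_of_nonneg_right (hM _ hj) (by positivity)
  · simpa [abs_mul, abs_pow] using
      mul_le_mul_of_nonneg_right (hM 0 (Nat.zero_le m)) (by positivity)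

theorem tendsto_cliqueRel_error (hq : |q| < 1) :
    Tendsto (fun m : ℕ => |q| ^ (m + 1) + ∑ j ∈ Finset.range m,
      ((m + 1).choose (j + 1) : ℝ) * (|q| ^ ((j + 2) * (m - j)))) atTop (𝓝 0) := by
  have h := ((tendsto_pow_atTop_nhds_zero_of_lt_one (abs_nonneg q) hq).comp
    (tendsto_add_atTop_nat 1)).add (tendsto_sum_choose_mul_pow (abs_nonneg q) hq)
  rw [add_zero] at h
  refine squeeze_zero (fun m => by positivity) (fun m => ?_) h
  refine add_le_add le_rfl (Finset.sum_le_sum fun j _ => mul_le_mul_of_nonneg_left ?_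
    (by positivity))
  exact pow_le_pow_of_le_one (abs_nonneg q) hq.le (Nat.mul_le_mul_right _ (by omega))

theorem exists_abs_cliqueRel_le (hq : |q| < 1) : ∃ M, ∀ m, |cliqueRel q m| ≤ M := by
  obtain ⟨N, hN⟩ := eventually_atTop.1
    ((tendsto_cliqueRel_error hq).eventually_le_const (show (0 : ℝ) < 1 / 2 by norm_num))
  set M := 2 + ∑ j ∈ Finset.range (N + 1), |cliqueRel q j| with hM
  have hM₂ : 2 ≤ M := le_add_of_nonneg_right (Finset.sum_nonneg fun _ _ => abs_nonneg _)
  refine ⟨M, fun m => ?_⟩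
  induction m using Nat.strong_induction_on with
  | _ m ih =>
  by_cases hm : m < N + 1
  · have := Finset.single_le_sum (f := fun j => |cliqueRel q j|) (fun _ _ => abs_nonneg _)
      (Finset.mem_range.2 hm)
    linarith
  · obtain ⟨k, rfl⟩ : ∃ k, m = k + 1 := ⟨m - 1, by omega⟩
    have h₁ := abs_cliqueRel_sub_one_le (M := M) (m := k) (fun j hj => ih j (by omega))
    have h₂ := mul_le_mul_of_nonneg_left (hN k (by omega)) (show 0 ≤ M by linarith)
    have h₃ := abs_sub_abs_le_abs_sub (cliqueRel q (k + 1)) 1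
    rw [abs_one] at h₃
    linarith

theorem tendsto_cliqueRel (hq : |q| < 1) : Tendsto (cliqueRel q) atTop (𝓝 1) := by
  obtain ⟨M, hM⟩ := exists_abs_cliqueRel_le hq
  rw [← tendsto_add_atTop_iff_nat 1, tendsto_iff_dist_tendsto_zero]
  refine squeeze_zero (fun _ => dist_nonneg)
    (fun m => abs_cliqueRel_sub_one_le (M := M) fun j _ => hM j) ?_
  simpa using (tendsto_cliqueRel_error hq).const_mul M

theorem tendsto_cliqueSplit (hq : |q| < 1) : Tendsto (cliqueSplit q) atTop (𝓝 2) := by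
  obtain ⟨M, hM⟩ := exists_abs_cliqueRel_le hq
  have hM₀ : 0 ≤ M := (abs_nonneg _).trans (hM 0)
  have hzero : cliqueRel q 0 = 1 := by rw [cliqueRel_eq]; simp
  have hmid : Tendsto (fun m : ℕ => ∑ j ∈ Finset.range m, ((m + 1).choose (j + 1) : ℝ) *
      (cliqueRel q (j + 1) * cliqueRel q (m - j) * q ^ ((j + 1) * (m - j)))) atTop (𝓝 0) := by
    refine squeeze_zero_norm (fun m => ?_)
      (by simpa using (tendsto_sum_choose_mul_pow (abs_nonneg q) hq).const_mul (M * M))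
    refine (norm_sum_le _ _).trans ?_
    rw [Finset.mul_sum]
    refine Finset.sum_le_sum fun j _ => ?_
    rw [Real.norm_eq_abs, abs_mul, abs_mul, abs_mul, abs_pow, Nat.abs_cast, mul_left_comm]
    exact mul_le_mul_of_nonneg_right (mul_le_mul (hM _) (hM _) (abs_nonneg _) hM₀)
      (by positivity)
  rw [← tendsto_add_atTop_iff_nat 1]
  have h := (((tendsto_cliqueRel hq).comp (tendsto_add_atTop_nat 1)).const_mul 2).add hmid
  simp only [mul_one, add_zero] at h
  refine h.congr fun m => ?_
  rw [cliqueSplit, Finset.sum_range_succ, Finset.sum_range_succ']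
  simp only [Nat.add_sub_add_right, Nat.sub_self, Nat.sub_zero, hzero, Nat.choose_self,
    Nat.choose_zero_right, Function.comp_apply]
  simp
  ring

end CliqueAsymptotics

section Chain

variable {α : Type*} [DecidableEq α]

/-- The edges of the union of the complete graphs on `blk 0`, …, `blk (n - 1)`. -/
def chainEdges (blk : ℕ → Finset α) (n : ℕ) : Finset (Sym2 α) :=
  (Finset.range n).biUnion fun i => cliqueEdges (blk i)

theorem chainEdges_succ (blk : ℕ → Finset α) (n : ℕ) :
    chainEdges blk (n + 1) = chainEdges blk n ∪ cliqueEdges (blk n) := by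
  rw [chainEdges, Finset.range_add_one, Finset.biUnion_insert, Finset.union_comm, chainEdges]

variable {blk S : ℕ → Finset α} {pt : ℕ → α} {n d : ℕ} {v c σ : ℝ}

theorem chainEdges_subset (hsucc : ∀ i < n, S (i + 1) = S i ∪ blk i) :
    chainEdges blk n ⊆ cliqueEdges (S n) := by
  induction n with
  | zero => simp [chainEdges]
  | succ n ih =>
    rw [chainEdges_succ, hsucc n n.lt_succ_self]
    exact Finset.union_subset
      ((ih fun i hi => hsucc i (by omega)).trans (cliqueEdges_mono Finset.subset_union_left))
      (cliqueEdges_mono Finset.subset_union_right)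

theorem disjoint_chainEdges (hsucc : ∀ i < n, S (i + 1) = S i ∪ blk i)
    (hinter : S n ∩ blk n = {pt n}) : Disjoint (chainEdges blk n) (cliqueEdges (blk n)) :=
  (disjoint_cliqueEdges hinter.le).mono_left (chainEdges_subset hsucc)

theorem card_chainEdges (hsucc : ∀ i < n, S (i + 1) = S i ∪ blk i)
    (hinter : ∀ i < n, S i ∩ blk i = {pt i}) (hcard : ∀ i < n, (blk i).card = d + 1) :
    (chainEdges blk n).card = n * (d + 1).choose 2 := by
  induction n with
  | zero => simp [chainEdges]
  | succ n ih =>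
    have hsucc' : ∀ i < n, S (i + 1) = S i ∪ blk i := fun i hi => hsucc i (by omega)
    rw [chainEdges_succ, Finset.card_union_of_disjoint
      (disjoint_chainEdges hsucc' (hinter n n.lt_succ_self)),
      ih hsucc' (fun i hi => hinter i (by omega)) (fun i hi => hcard i (by omega)),
      card_cliqueEdges, hcard n n.lt_succ_self]
    ring

theorem edgeSum_spans_chainEdges (hzero : S 0 = {pt 0})
    (hsucc : ∀ i < n, S (i + 1) = S i ∪ blk i) (hinter : ∀ i < n, S i ∩ blk i = {pt i})
    (hc : ∀ i < n, edgeSum v (cliqueEdges (blk i)) (Spans (blk i)) = c) :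
    edgeSum v (chainEdges blk n) (Spans (S n)) = c ^ n := by
  induction n with
  | zero =>
    have : Spans ({pt 0} : Finset α) ∅ := by
      intro x hx y hy
      rw [Finset.mem_singleton] at hx hy
      rw [hx, hy]
      exact EdgeReach.refl _ _
    simp [chainEdges, edgeSum, hzero, this]
  | succ n ih =>
    have hsucc' : ∀ i < n, S (i + 1) = S i ∪ blk i := fun i hi => hsucc i (by omega)
    have hn := hinter n n.lt_succ_self
    rw [chainEdges_succ, hsucc n n.lt_succ_self, edgeSum_union (disjoint_chainEdges hsucc' hn)
      (P₁ := Spans (S n)) (P₂ := Spans (blk n)), hc n n.lt_succ_self, pow_succ,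
      ih hsucc' (fun i hi => hinter i (by omega)) (fun i hi => hc i (by omega))]
    intro A₁ h₁ A₂ h₂
    exact spans_union_iff ((edgesIn_cliqueEdges _).mono (h₁.trans (chainEdges_subset hsucc'))
      subset_rfl) ((edgesIn_cliqueEdges _).mono h₂ subset_rfl) hn

theorem edgeSum_splits_chainEdges (hzero : S 0 = {pt 0})
    (hsucc : ∀ i < n, S (i + 1) = S i ∪ blk i) (hinter : ∀ i < n, S i ∩ blk i = {pt i})
    (hpt : ∀ i < n, pt (i + 1) ∈ blk i)
    (hc : ∀ i < n, edgeSum v (cliqueEdges (blk i)) (Spans (blk i)) = c)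
    (hσ : ∀ i < n, edgeSum v (cliqueEdges (blk i)) (Splits (blk i) (pt i) (pt (i + 1))) = σ) :
    edgeSum v (chainEdges blk n) (Splits (S n) (pt 0) (pt n)) = n * c ^ (n - 1) * σ := by
  induction n with
  | zero =>
    have : ¬ Splits (S 0) (pt 0) (pt 0) ∅ := fun h => h.1 (EdgeReach.refl _ _)
    simp [chainEdges, edgeSum, this]
  | succ n ih =>
    have hsucc' : ∀ i < n, S (i + 1) = S i ∪ blk i := fun i hi => hsucc i (by omega)
    have hinter' : ∀ i < n, S i ∩ blk i = {pt i} := fun i hi => hinter i (by omega)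
    have hn := hinter n n.lt_succ_self
    have hdisj := disjoint_chainEdges hsucc' hn
    have hmem : pt 0 ∈ S n := by
      have : ∀ i ≤ n, pt 0 ∈ S i := by
        intro i
        induction i with
        | zero => simp [hzero]
        | succ i ih => exact fun hi => hsucc i (by omega) ▸ Finset.mem_union_left _ (ih (by omega))
      exact this n le_rfl
    have hin₁ : ∀ A ⊆ chainEdges blk n, EdgesIn A (S n) := fun A hA =>
      (edgesIn_cliqueEdges _).mono (hA.trans (chainEdges_subset hsucc')) subset_rfl
    have hin₂ : ∀ A ⊆ cliqueEdges (blk n), EdgesIn A (blk n) := fun A hA =>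
      (edgesIn_cliqueEdges _).mono hA subset_rfl
    rw [chainEdges_succ, hsucc n n.lt_succ_self]
    have hsplit : edgeSum v (chainEdges blk n ∪ cliqueEdges (blk n))
        (Splits (S n ∪ blk n) (pt 0) (pt (n + 1))) =
        edgeSum v (chainEdges blk n ∪ cliqueEdges (blk n)) fun A =>
          (Splits (S n) (pt 0) (pt n) (A ∩ chainEdges blk n) ∧
            Spans (blk n) (A ∩ cliqueEdges (blk n))) ∨
          (Spans (S n) (A ∩ chainEdges blk n) ∧
            Splits (blk n) (pt n) (pt (n + 1)) (A ∩ cliqueEdges (blk n))) := by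
      refine edgeSum_congr fun A hA => ?_
      rw [← splits_union_iff (hin₁ _ Finset.inter_subset_right) (hin₂ _ Finset.inter_subset_right)
        hn hmem (hpt n n.lt_succ_self), ← Finset.inter_union_distrib_left,
        Finset.inter_eq_left.2 hA]
    rw [hsplit, edgeSum_or]
    · rw [edgeSum_union hdisj (P₁ := Splits (S n) (pt 0) (pt n)) (P₂ := Spans (blk n)),
        edgeSum_union hdisj (P₁ := Spans (S n)) (P₂ := Splits (blk n) (pt n) (pt (n + 1))),
        ih hsucc' hinter' (fun i hi => hpt i (by omega)) (fun i hi => hc i (by omega))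
          (fun i hi => hσ i (by omega)),
        edgeSum_spans_chainEdges hzero hsucc' hinter' (fun i hi => hc i (by omega)),
        hc n n.lt_succ_self, hσ n n.lt_succ_self]
      · rcases n with _ | n
        · simp
        · push_cast
          ring
      all_goals
        intro A₁ h₁ A₂ h₂
        rw [(union_inter_of_disjoint hdisj h₁ h₂).1, (union_inter_of_disjoint hdisj h₁ h₂).2]
    · rintro A hA ⟨h, -⟩ ⟨h', -⟩
      have : pt n ∈ S n := (Finset.mem_inter.1 (hn ▸ Finset.mem_singleton_self (pt n))).1
      exact h.1 (h' _ hmem _ this)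

/-- Closing up with the edge `uw`. -/
theorem edgeSum_spans_insert {F : Finset (Sym2 α)} {T : Finset α} {u w : α} (hu : u ∈ T)
    (hw : w ∈ T) (he : s(u, w) ∉ F) :
    edgeSum v (insert s(u, w) F) (Spans T) = edgeSum v F (Spans T) +
      v * (edgeSum v F (Spans T) + edgeSum v F (Splits T u w)) := by
  rw [← edgeSum_or fun A _ h h' => h'.1 (h u hu w hw)]
  simp only [← spans_insert_iff hu hw]
  rw [edgeSum, Finset.sum_powerset_insert he, edgeSum, edgeSum, Finset.mul_sum]
  refine congrArg _ (Finset.sum_congr rfl fun A hA => ?_)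
  rw [Finset.card_insert_of_notMem fun h => he (Finset.mem_powerset.1 hA h), mul_ite, mul_zero,
    pow_succ']

end Chain

section Bridge

variable {V : Type} [Finite V]

theorem mem_edgeFin {G : SimpleGraph V} {e : Sym2 V} : e ∈ edgeFin G ↔ e ∈ G.edgeSet := by
  simp [edgeFin]

omit [Finite V] in
theorem connected_fromEdgeSet_iff [Fintype V] [Nonempty V] (A : Finset (Sym2 V)) :
    (SimpleGraph.fromEdgeSet (A : Set (Sym2 V))).Connected ↔ Spans Finset.univ A := by
  rw [SimpleGraph.connected_iff]
  exact ⟨fun h x _ y _ => h.1 x y,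
    fun h => ⟨fun x y => h x (Finset.mem_univ _) y (Finset.mem_univ _), inferInstance⟩⟩

theorem relPoly_eq_edgeSum [Fintype V] [Nonempty V] (G : SimpleGraph V) {q : ℝ} (hq : q ≠ 0) :
    relPoly G q =
      q ^ (edgeFin G).card * edgeSum (q⁻¹ - 1) (edgeFin G) (Spans Finset.univ) := by
  rw [relPoly, edgeSum, Finset.mul_sum]
  refine Finset.sum_congr rfl fun A hA => ?_
  rw [mul_ite, mul_zero]
  by_cases hc : Spans Finset.univ A
  swap
  · rw [if_neg hc, if_neg (mt (connected_fromEdgeSet_iff A).1 hc)]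
  rw [if_pos hc, if_pos ((connected_fromEdgeSet_iff A).2 hc)]
  obtain ⟨k, hk⟩ := Nat.exists_eq_add_of_le (Finset.card_le_card (Finset.mem_powerset.1 hA))
  have : 1 - q = q * (q⁻¹ - 1) := by field_simp
  rw [hk, Nat.add_sub_cancel_left, this, mul_pow, pow_add]
  ring

theorem connected_of_relPoly_ne_zero {G : SimpleGraph V} {q : ℝ} (h : relPoly G q ≠ 0) :
    G.Connected := by
  obtain ⟨A, hA, hne⟩ := Finset.exists_ne_zero_of_sum_ne_zero h
  have hc : (SimpleGraph.fromEdgeSet (A : Set (Sym2 V))).Connected := by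
    by_contra hc
    simp [hc] at hne
  refine hc.mono fun x y hxy => ?_
  rw [SimpleGraph.fromEdgeSet_adj] at hxy
  exact mem_edgeFin.1 (Finset.mem_powerset.1 hA (Finset.mem_coe.1 hxy.1))

theorem continuous_relPoly (G : SimpleGraph V) : Continuous (relPoly G) := by
  refine continuous_finsetSum _ fun A _ => ?_
  split_ifs <;> fun_prop

end Bridge

section Ring

/-- `n` complete graphs on `d + 1` vertices in a row, consecutive ones sharing a vertex, closed up
by one further edge. -/
def ringGraph (d n : ℕ) : SimpleGraph (Fin (d * n + 1)) :=
  SimpleGraph.fromEdgeSet (insert s(Fin.ofNat (d * n + 1) (d * 0), Fin.ofNat (d * n + 1) (d * n))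
    (chainEdges (fun i => Finset.univ.filter fun x : Fin (d * n + 1) =>
      d * i ≤ x.val ∧ x.val ≤ d * (i + 1)) n) : Finset (Sym2 (Fin (d * n + 1))))

theorem relPoly_ringGraph {q : ℝ} (hq : q ≠ 0) {d n : ℕ} (hd : 1 ≤ d) (hn : 2 ≤ n) :
    relPoly (ringGraph d n) q = cliqueRel q d ^ (n - 1) * (cliqueRel q d +
      (1 - q) * n * (q ^ d * cliqueSplit q (d - 1))) := by
  obtain ⟨d, rfl⟩ := Nat.exists_eq_add_of_le' hd
  obtain ⟨n, rfl⟩ := Nat.exists_eq_add_of_le' hn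
  simp only [Nat.add_sub_cancel]
  set d' := d + 1 with hd'
  set n' := n + 2 with hn'
  let blk : ℕ → Finset (Fin (d' * n' + 1)) := fun i => Finset.univ.filter fun x =>
    d' * i ≤ x.val ∧ x.val ≤ d' * (i + 1)
  let S : ℕ → Finset (Fin (d' * n' + 1)) := fun i => Finset.univ.filter fun x => x.val ≤ d' * i
  let pt : ℕ → Fin (d' * n' + 1) := fun i => Fin.ofNat _ (d' * i)
  have hval : ∀ i ≤ n', (pt i).val = d' * i := fun i hi =>
    Nat.mod_eq_of_lt (Nat.lt_succ_of_le (Nat.mul_le_mul_left _ hi))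
  have hstep : ∀ i, d' * (i + 1) = d' * i + d' := fun i => by ring
  have hle : ∀ i < n', d' * (i + 1) ≤ d' * n' := fun i hi => Nat.mul_le_mul_left _ hi
  have hzero : S 0 = {pt 0} := by
    ext x
    have := hval 0 (Nat.zero_le _)
    simp only [S, Finset.mem_filter_univ, Finset.mem_singleton, Fin.ext_iff]
    omega
  have hsucc : ∀ i < n', S (i + 1) = S i ∪ blk i := by
    intro i hi
    ext x
    have := hstep i
    simp only [S, blk, Finset.mem_union, Finset.mem_filter_univ]
    omega
  have hinter : ∀ i < n', S i ∩ blk i = {pt i} := by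
    intro i hi
    ext x
    have := hstep i
    have := hval i hi.le
    simp only [S, blk, Finset.mem_inter, Finset.mem_filter_univ, Finset.mem_singleton,
      Fin.ext_iff]
    omega
  have hptl : ∀ i < n', pt i ∈ blk i := by
    intro i hi
    exact (Finset.mem_inter.1 (hinter i hi ▸ Finset.mem_singleton_self (pt i))).2
  have hpt : ∀ i < n', pt (i + 1) ∈ blk i := by
    intro i hi
    have := hstep i
    have := hval (i + 1) hi
    simp only [blk, Finset.mem_filter_univ]
    omega
  have hne : ∀ i < n', pt i ≠ pt (i + 1) := by
    intro i hi
    have := hstep i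
    have := hval i hi.le
    have := hval (i + 1) hi
    rw [Ne, Fin.ext_iff]
    omega
  have hcard : ∀ i < n', (blk i).card = d + 2 := by
    intro i hi
    have h : (blk i).map Fin.valEmbedding = Finset.Icc (d' * i) (d' * (i + 1)) := by
      ext x
      have := hle i hi
      simp only [blk, Finset.mem_map, Finset.mem_filter_univ, Fin.valEmbedding_apply,
        Finset.mem_Icc]
      exact ⟨fun ⟨y, hy, hyx⟩ => hyx ▸ hy, fun hx => ⟨⟨x, by omega⟩, hx, rfl⟩⟩
    have := hstep i
    rw [← Finset.card_map, h, Nat.card_Icc]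
    omega
  have htop : S n' = Finset.univ := by
    ext x
    have := x.isLt
    simp only [S, Finset.mem_filter_univ, Finset.mem_univ, iff_true]
    omega
  have hclose : s(pt 0, pt n') ∉ chainEdges blk n' := by
    intro h
    obtain ⟨i, hi, h⟩ := Finset.mem_biUnion.1 h
    obtain ⟨h₁, h₂, -⟩ := mk_mem_cliqueEdges.1 h
    simp only [blk, Finset.mem_filter_univ, hval 0 (Nat.zero_le _), hval n' le_rfl] at h₁ h₂
    have : d' * n' ≤ d' * 1 := by
      have : d' * i ≤ 0 := by omega
      have := hstep i
      omega
    have := Nat.le_of_mul_le_mul_left this (by omega)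
    omega
  have hedge : edgeFin (ringGraph d' n') = insert s(pt 0, pt n') (chainEdges blk n') := by
    ext e
    rw [mem_edgeFin, ringGraph, SimpleGraph.edgeSet_fromEdgeSet, Set.mem_sdiff, Finset.mem_coe]
    refine and_iff_left_of_imp fun he => ?_
    rcases Finset.mem_insert.1 he with rfl | he
    · have h₀ := hval 0 (Nat.zero_le _)
      have h₁ := hval n' le_rfl
      have : 0 < d' * n' := by positivity
      intro h
      have : pt 0 = pt n' := Sym2.mk_isDiag_iff.1 h
      rw [Fin.ext_iff] at this
      omega
    · obtain ⟨i, -, hi⟩ := Finset.mem_biUnion.1 he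
      induction e with
      | _ a b => simpa using (mk_mem_cliqueEdges.1 hi).2.2
  have hpow : q ^ (d + 2).choose 2 ≠ 0 := pow_ne_zero _ hq
  have hc : ∀ i < n', edgeSum (q⁻¹ - 1) (cliqueEdges (blk i)) (Spans (blk i)) =
      cliqueRel q d' / q ^ (d + 2).choose 2 := fun i hi => by
    rw [eq_div_iff hpow, mul_comm, ← edgeSum_spans_cliqueEdges hq d' (blk i) (hcard i hi)]
  have hσ : ∀ i < n', edgeSum (q⁻¹ - 1) (cliqueEdges (blk i))
      (Splits (blk i) (pt i) (pt (i + 1))) =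
      q ^ d' * cliqueSplit q d / q ^ (d + 2).choose 2 := fun i hi => by
    rw [eq_div_iff hpow, mul_comm, ← edgeSum_splits_cliqueEdges_eq hq d (blk i) (hcard i hi)
      (hptl i hi) (hpt i hi) (hne i hi)]
  rw [relPoly_eq_edgeSum _ hq, hedge, edgeSum_spans_insert (Finset.mem_univ _)
    (Finset.mem_univ _) hclose, ← htop, edgeSum_spans_chainEdges hzero hsucc hinter hc,
    edgeSum_splits_chainEdges hzero hsucc hinter hpt hc hσ, Finset.card_insert_of_notMem hclose,
    card_chainEdges hsucc hinter hcard, hn']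
  simp only [show n + 2 - 1 = n + 1 from rfl, show d + 1 + 1 = d + 2 from rfl]
  rw [pow_succ q, mul_comm (n + 2), pow_mul, div_pow, div_pow]
  set Q := q ^ (d + 2).choose 2
  field_simp
  ring

end Ring

section Density

open Filter Topology

theorem exists_ringGraph_relPoly_neg_pos {s t : ℝ} (ht : 0 < t) (hts : t < s) (hs : s < 1) :
    ∃ d n, relPoly (ringGraph d n) (-s) < 0 ∧ 0 < relPoly (ringGraph d n) (-t) := by
  have hs₀ : 0 < s := ht.trans hts
  have hsabs : |-s| < 1 := by rwa [abs_neg, abs_of_pos hs₀]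
  have htabs : |-t| < 1 := by rw [abs_neg, abs_of_pos ht]; linarith
  have hr₀ : 0 ≤ t / s := by positivity
  have hr₁ : t / s < 1 := (div_lt_one hs₀).2 hts
  obtain ⟨D, hD⟩ := eventually_atTop.1
    (((tendsto_cliqueRel hsabs).eventually
        (Ioo_mem_nhds (a := 3 / 4) (b := 5 / 4) (by norm_num) (by norm_num))).and <|
      ((tendsto_cliqueRel htabs).eventually_const_lt (u := 3 / 4) (by norm_num)).and <|
      ((tendsto_cliqueSplit hsabs).eventually_const_lt (u := 3 / 2) (by norm_num)).and <|
      ((tendsto_cliqueSplit htabs).eventually_lt_const (u := 3) (by norm_num)).and <|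
      (tendsto_pow_atTop_nhds_zero_of_lt_one hr₀ hr₁).eventually_lt_const
        (u := 1 / 24) (by norm_num))
  obtain ⟨⟨hR₁, hR₂⟩, hR', -, -, hpow⟩ := hD (2 * D + 1) (by omega)
  obtain ⟨-, -, hT, hT', -⟩ := hD (2 * D) (by omega)
  have hodd : Odd (2 * D + 1) := odd_two_mul_add_one D
  set d := 2 * D + 1 with hd
  set x := s ^ d with hx
  have hx₀ : 0 < x := by positivity
  have hx₁ : x < 1 := pow_lt_one₀ hs₀.le hs (by omega)
  set n := ⌈x⁻¹⌉₊ with hn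
  have hn₂ : 2 ≤ n := Nat.lt_ceil.2 (by simpa using (one_lt_inv₀ hx₀).2 hx₁)
  have hnl : 1 ≤ n * x := by
    rw [← inv_mul_cancel₀ hx₀.ne']
    exact mul_le_mul_of_nonneg_right (Nat.le_ceil _) hx₀.le
  have hnu : n * x ≤ 2 := by
    have h := mul_le_mul_of_nonneg_right (Nat.ceil_lt_add_one (inv_nonneg.2 hx₀.le)).le hx₀.le
    rw [add_mul, inv_mul_cancel₀ hx₀.ne', ← hn] at h
    linarith
  have hy : t ^ d = x * (t / s) ^ d := by
    rw [hx, ← mul_pow, mul_div_cancel₀ _ hs₀.ne']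
  refine ⟨d, n, ?_, ?_⟩
  · rw [relPoly_ringGraph (neg_ne_zero.2 hs₀.ne') (by omega) hn₂, show d - 1 = 2 * D by omega,
      hodd.neg_pow, ← hx]
    refine mul_neg_of_pos_of_neg (pow_pos (by linarith) _) ?_
    have h₁ : 3 / 2 ≤ (1 + s) * ((n * x) * cliqueSplit (-s) (2 * D)) := by
      nlinarith [mul_le_mul hnl hT.le (by norm_num) (by linarith)]
    linarith
  · rw [relPoly_ringGraph (neg_ne_zero.2 ht.ne') (by omega) hn₂, show d - 1 = 2 * D by omega,
      hodd.neg_pow, hy]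
    refine mul_pos (pow_pos (by linarith) _) ?_
    have h₀ : 0 ≤ (1 + t) * ((n * x) * (t / s) ^ d) := by positivity
    have h₁ : (1 + t) * ((n * x) * (t / s) ^ d) ≤ 2 * (2 * (1 / 24)) :=
      mul_le_mul (by linarith) (mul_le_mul hnu hpow.le (by positivity) (by norm_num))
        (by positivity) (by norm_num)
    have h₂ := mul_le_mul_of_nonneg_left hT'.le h₀
    linarith

theorem exists_relPoly_eq_zero {a b : ℝ} (ha : -1 < a) (hab : a < b) (hb : b < 0) :
    ∃ q ∈ Set.Icc a b, ∃ (V : Type) (_ : Finite V) (G : SimpleGraph V),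
      G.Connected ∧ relPoly G q = 0 := by
  obtain ⟨d, n, h₁, h₂⟩ := exists_ringGraph_relPoly_neg_pos (s := -a) (t := -b) (by linarith)
    (by linarith) (by linarith)
  rw [neg_neg] at h₁ h₂
  obtain ⟨q, hq, hroot⟩ := intermediate_value_Icc hab.le
    (continuous_relPoly (ringGraph d n)).continuousOn ⟨h₁.le, h₂.le⟩
  exact ⟨q, hq, _, inferInstance, ringGraph d n, connected_of_relPoly_ne_zero h₁.ne, hroot⟩

end Density

section RootBounds

variable {α : Type*} [Fintype α] [DecidableEq α] {v : ℝ}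

/-- Every vertex is joined by `A` to some vertex of `X`. -/
def Covers (X : Finset α) (A : Finset (Sym2 α)) : Prop := ∀ w, ∃ x ∈ X, EdgeReach A x w

omit [Fintype α] in
theorem covers_union_iff {X : Finset α} {b : α} {A₁ A₂ : Finset (Sym2 α)}
    (hA : A₁.Nonempty) (h : ∀ e ∈ A₁, ∃ x ∈ X, e = s(x, b)) :
    Covers X (A₁ ∪ A₂) ↔ Covers (insert b X) A₂ := by
  constructor
  · intro hc w
    obtain ⟨x, hx, hw⟩ := hc w
    refine hw.induct (P := fun w => ∃ x ∈ insert b X, EdgeReach A₂ x w) ?_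
      ⟨x, Finset.mem_insert_of_mem hx, EdgeReach.refl _ _⟩
    rintro c d hcd ⟨y, hy, hyc⟩
    rcases Finset.mem_union.1 hcd with h' | h'
    · obtain ⟨z, hz, hcz⟩ := h _ h'
      rcases Sym2.eq_iff.1 hcz with ⟨rfl, rfl⟩ | ⟨rfl, rfl⟩
      · exact ⟨_, Finset.mem_insert_self _ _, EdgeReach.refl _ _⟩
      · exact ⟨_, Finset.mem_insert_of_mem hz, EdgeReach.refl _ _⟩
    · exact ⟨y, hy, hyc.trans (EdgeReach.of_mem h')⟩
  · intro hc w
    obtain ⟨y, hy, hyw⟩ := hc w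
    have hyw' := hyw.mono (B := A₁ ∪ A₂) Finset.subset_union_right
    rcases Finset.mem_insert.1 hy with rfl | hy
    · obtain ⟨e, he⟩ := hA
      obtain ⟨x, hx, rfl⟩ := h e he
      exact ⟨x, hx, (EdgeReach.of_mem (Finset.mem_union_left _ he)).trans hyw'⟩
    · exact ⟨y, hy, hyw'⟩

omit [Fintype α] in
theorem edgeSum_covers_union {X : Finset α} {b : α} {F₁ F₂ : Finset (Sym2 α)}
    (hF : Disjoint F₁ F₂) (h : ∀ e ∈ F₁, ∃ x ∈ X, e = s(x, b)) :
    edgeSum v (F₁ ∪ F₂) (Covers X) = edgeSum v F₂ (Covers X) +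
      ((1 + v) ^ F₁.card - 1) * edgeSum v F₂ (Covers (insert b X)) := by
  have hsplit : edgeSum v (F₁ ∪ F₂) (Covers X) = edgeSum v (F₁ ∪ F₂) fun A =>
      (A ∩ F₁ = ∅ ∧ Covers X (A ∩ F₂)) ∨ ((A ∩ F₁).Nonempty ∧ Covers (insert b X) (A ∩ F₂)) := by
    refine edgeSum_congr fun A hA => ?_
    have hA' : A ∩ F₁ ∪ A ∩ F₂ = A := by
      rw [← Finset.inter_union_distrib_left, Finset.inter_eq_left.2 hA]
    rcases (A ∩ F₁).eq_empty_or_nonempty with h₁ | h₁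
    · rw [h₁, Finset.empty_union] at hA'
      simp [h₁, hA']
    · rw [← covers_union_iff (A₂ := A ∩ F₂) h₁ fun e he => h e (Finset.mem_inter.1 he).2, hA']
      simp [h₁, h₁.ne_empty]
  have hempty : edgeSum v F₁ (fun A => A = ∅) = 1 := by
    rw [edgeSum, Finset.sum_eq_single ∅] <;> simp +contextual
  have hnonempty : edgeSum v F₁ (fun A => A.Nonempty) = (1 + v) ^ F₁.card - 1 := by
    rw [eq_sub_iff_add_eq', ← edgeSum_true, ← hempty, ← edgeSum_or]
    · exact edgeSum_congr fun A _ => by simp [Finset.eq_empty_or_nonempty]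
    · rintro A - rfl
      simp
  rw [hsplit, edgeSum_or, edgeSum_union hF (P₁ := fun A => A = ∅) (P₂ := Covers X),
    edgeSum_union hF (P₁ := fun A => A.Nonempty) (P₂ := Covers (insert b X)), hempty,
    hnonempty, one_mul]
  · intro A₁ h₁ A₂ h₂
    rw [(union_inter_of_disjoint hF h₁ h₂).1, (union_inter_of_disjoint hF h₁ h₂).2]
  · intro A₁ h₁ A₂ h₂
    rw [(union_inter_of_disjoint hF h₁ h₂).1, (union_inter_of_disjoint hF h₁ h₂).2]
  · rintro A - ⟨h₁, -⟩ ⟨h₂, -⟩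
    exact h₂.ne_empty h₁

theorem edgeSum_covers_sign (hv : |1 + v| < 1) (X : Finset α) (F : Finset (Sym2 α))
    (hF : ∀ a b, s(a, b) ∈ F → a ≠ b ∧ (a ∉ X ∨ b ∉ X)) :
    0 ≤ (-1) ^ Xᶜ.card * edgeSum v F (Covers X) ∧
      (Covers X F → 0 < (-1) ^ Xᶜ.card * edgeSum v F (Covers X)) := by
  induction hk : F.card using Nat.strong_induction_on generalizing X F with
  | _ k ih =>
  subst hk
  by_cases hedge : ∃ b ∉ X, ∃ x ∈ X, s(x, b) ∈ F
  · obtain ⟨b, hb, x, hx, hxb⟩ := hedge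
    classical
    set F₁ := F.filter fun e => ∃ x ∈ X, e = s(x, b) with hF₁
    set F₂ := F.filter fun e => ¬ ∃ x ∈ X, e = s(x, b) with hF₂
    have hunion : F₁ ∪ F₂ = F := Finset.filter_union_filter_not_eq _ F
    have hdisj : Disjoint F₁ F₂ := Finset.disjoint_filter_filter_not F F _
    have hspec : ∀ e ∈ F₁, ∃ x ∈ X, e = s(x, b) := fun e he => (Finset.mem_filter.1 he).2
    have hmem : s(x, b) ∈ F₁ := Finset.mem_filter.2 ⟨hxb, x, hx, rfl⟩
    have hlt : F₂.card < F.card := by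
      rw [← hunion, Finset.card_union_of_disjoint hdisj]
      have := Finset.card_pos.2 ⟨_, hmem⟩
      omega
    have hcompl : Xᶜ.card = (insert b X)ᶜ.card + 1 := by
      rw [Finset.compl_insert, Finset.card_erase_add_one (Finset.mem_compl.2 hb)]
    obtain ⟨h₁, -⟩ := ih _ hlt X F₂ (fun c d hcd => hF c d (Finset.mem_filter.1 hcd).1) rfl
    obtain ⟨h₂, h₃⟩ := ih _ hlt (insert b X) F₂ (fun c d hcd => by
      obtain ⟨hcd, hn⟩ := Finset.mem_filter.1 hcd
      obtain ⟨hne, h⟩ := hF c d hcd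
      refine ⟨hne, ?_⟩
      by_contra! hcon
      simp only [Finset.mem_insert] at hcon
      rcases hcon with ⟨rfl | hc, rfl | hd⟩
      · exact hne rfl
      · exact hn ⟨d, hd, Sym2.eq_swap⟩
      · exact hn ⟨c, hc, rfl⟩
      · exact h.elim (· hc) (· hd)) rfl
    have hcoef : 0 < 1 - (1 + v) ^ F₁.card := by
      have : |(1 + v) ^ F₁.card| < 1 := by
        rw [abs_pow]
        exact pow_lt_one₀ (abs_nonneg _) hv (Finset.card_pos.2 ⟨_, hmem⟩).ne'
      linarith [(abs_lt.1 this).2]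
    have heq : (-1) ^ Xᶜ.card * edgeSum v F (Covers X) =
        (-1) ^ Xᶜ.card * edgeSum v F₂ (Covers X) + (1 - (1 + v) ^ F₁.card) *
          ((-1) ^ (insert b X)ᶜ.card * edgeSum v F₂ (Covers (insert b X))) := by
      conv_lhs => rw [← hunion]
      rw [edgeSum_covers_union hdisj hspec, hcompl, pow_succ]
      ring
    rw [heq]
    refine ⟨by positivity, fun hc => ?_⟩
    rw [← hunion, covers_union_iff ⟨_, hmem⟩ hspec] at hc
    have := h₃ hc
    positivity
  · push Not at hedge
    have hstuck : ∀ A ⊆ F, Covers X A → X = Finset.univ := by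
      intro A hA hc
      refine Finset.eq_univ_of_forall fun w => ?_
      obtain ⟨x, hx, hw⟩ := hc w
      refine hw.induct (P := (· ∈ X)) (fun a b hab ha => ?_) hx
      by_contra hb
      exact hedge b hb a ha (hA hab)
    by_cases hX : X = Finset.univ
    · have hempty : F = ∅ := by
        refine Finset.eq_empty_of_forall_notMem fun e he => ?_
        induction e with
        | _ a b => simpa [hX] using (hF a b he).2
      have hc : Covers X (∅ : Finset (Sym2 α)) :=
        fun w => ⟨w, hX ▸ Finset.mem_univ w, EdgeReach.refl _ _⟩
      have : edgeSum v F (Covers X) = 1 := by simp [edgeSum, hempty, hc]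
      rw [this]
      simp [hX]
    · have : edgeSum v F (Covers X) = 0 := by
        rw [← edgeSum_false (v := v) (F := F)]
        exact edgeSum_congr fun A hA => iff_false_intro fun hc => hX (hstuck A hA hc)
      exact ⟨by simp [this], fun hc => absurd (hstuck F subset_rfl hc) hX⟩

end RootBounds

section RootLocation

variable {V : Type} [Finite V] {G : SimpleGraph V} {q : ℝ}

theorem connected_fromEdgeSet_edgeFin (hG : G.Connected) :
    (SimpleGraph.fromEdgeSet (edgeFin G : Set (Sym2 V))).Connected := by
  have : (edgeFin G : Set (Sym2 V)) = G.edgeSet := by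
    ext e
    simp [mem_edgeFin]
  rwa [this, SimpleGraph.fromEdgeSet_edgeSet]

theorem relPoly_pos_of_mem_Ioo (hG : G.Connected) (h₀ : 0 < q) (h₁ : q < 1) :
    0 < relPoly G q := by
  have hq : 0 < 1 - q := by linarith
  refine Finset.sum_pos' (fun A _ => ?_) ⟨edgeFin G, Finset.mem_powerset_self _, ?_⟩
  · split_ifs <;> positivity
  · rw [if_pos (connected_fromEdgeSet_edgeFin hG)]
    positivity

theorem relPoly_ne_zero_of_one_lt_abs (hG : G.Connected) (hq : 1 < |q|) : relPoly G q ≠ 0 := by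
  classical
  have := Fintype.ofFinite V
  have := hG.nonempty
  obtain ⟨r⟩ := hG.nonempty
  have hq₀ : q ≠ 0 := by
    rintro rfl
    norm_num at hq
  have hcov : ∀ A : Finset (Sym2 V), Spans Finset.univ A ↔ Covers {r} A := by
    intro A
    simp only [Covers, Finset.mem_singleton, exists_eq_left]
    exact ⟨fun h w => h r (Finset.mem_univ _) w (Finset.mem_univ _),
      fun h x _ y _ => (h x).symm.trans (h y)⟩
  rw [relPoly_eq_edgeSum G hq₀, edgeSum_congr fun A _ => hcov A]
  refine mul_ne_zero (pow_ne_zero _ hq₀) fun hzero => ?_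
  have h := (edgeSum_covers_sign (v := q⁻¹ - 1) (by
    rw [add_sub_cancel, abs_inv]
    exact inv_lt_one_of_one_lt₀ hq) {r} (edgeFin G) fun a b hab => by
      have hne : a ≠ b := (mem_edgeFin.1 hab : G.Adj a b).ne
      refine ⟨hne, ?_⟩
      simp only [Finset.mem_singleton]
      by_contra! hcon
      exact hne (hcon.1.trans hcon.2.symm)).2
    ((hcov _).1 ((connected_fromEdgeSet_iff _).1 (connected_fromEdgeSet_edgeFin hG)))
  rw [hzero, mul_zero] at h
  exact lt_irrefl _ h

theorem mem_of_relPoly_eq_zero (hG : G.Connected) (h : relPoly G q = 0) :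
    q ∈ Set.Icc (-1 : ℝ) 0 ∪ {1} := by
  have habs : |q| ≤ 1 := not_lt.1 fun hq => relPoly_ne_zero_of_one_lt_abs hG hq h
  obtain ⟨h₁, h₂⟩ := abs_le.1 habs
  rcases le_or_gt q 0 with h₀ | h₀
  · exact Or.inl ⟨h₁, h₀⟩
  · exact Or.inr (h₂.eq_of_not_lt fun hlt => (relPoly_pos_of_mem_Ioo hG h₀ hlt).ne' h)

theorem relPoly_top_fin_two_one : relPoly (⊤ : SimpleGraph (Fin 2)) 1 = 0 := by
  refine Finset.sum_eq_zero fun A _ => ?_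
  rcases A.eq_empty_or_nonempty with rfl | hA
  · rw [if_neg]
    intro h
    simpa using h.preconnected 0 1
  · simp [hA.ne_empty]

end RootLocation

/-- The closure of the set of real roots of all-terminal reliability polynomials of finite
connected simple graphs is exactly `[-1, 0] ∪ {1}`. -/
theorem closure_real_reliability_roots :
    closure {q : ℝ | ∃ (V : Type) (_ : Finite V) (G : SimpleGraph V),
        G.Connected ∧ relPoly G q = 0} = Set.Icc (-1 : ℝ) 0 ∪ {1} := by
  refine Set.Subset.antisymm (closure_minimal ?_ (isClosed_Icc.union isClosed_singleton))
    (Set.union_subset ?_ ?_)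
  · rintro q ⟨V, _, G, hG, h⟩
    exact mem_of_relPoly_eq_zero hG h
  · rw [← closure_Ioo (by norm_num : (-1 : ℝ) ≠ 0)]
    refine closure_minimal (fun x hx => ?_) isClosed_closure
    rw [Metric.mem_closure_iff]
    intro ε hε
    obtain ⟨b, hxb, hb⟩ := exists_between (lt_min hx.2 (lt_add_of_pos_right x hε))
    obtain ⟨q, hq, hroot⟩ := exists_relPoly_eq_zero hx.1 hxb (hb.trans_le (min_le_left _ _))
    refine ⟨q, hroot, ?_⟩
    rw [Real.dist_eq, abs_sub_comm, abs_of_nonneg (sub_nonneg.2 hq.1)]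
    linarith [hq.2, hb.trans_le (min_le_right _ _)]
  · exact Set.singleton_subset_iff.2 (subset_closure
      ⟨Fin 2, inferInstance, ⊤, SimpleGraph.connected_top, relPoly_top_fin_two_one⟩)

end
end

section
/- Let K ⊂ (-1,0) be a compact set, let s be an integer, and for each integer N ≥ 2 and each a with 1 ≤ a ≤ N-1 let b_{N,a} : ℝ → ℝ be a real-valued function such that sup { |b_{N,a}(q)| : N ≥ 2, 1 ≤ a ≤ N-1, q ∈ K } < ∞. Then sup_{q ∈ K} | Σ_{a=1}^{N-1} binomial(N,a) · b_{N,a}(q) · q^{a(N-a)+s} | → 0 as N → ∞. -/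
open Finset Filter

theorem choose_mul_pow_le {r : ℝ} (hr0 : 0 ≤ r) (hr1 : r ≤ 1) {N a : ℕ}
    (hN : (N : ℝ) * r ^ N ≤ 1) (ha : 1 ≤ a) (haN : 2 * a ≤ N) :
    (N.choose a : ℝ) * (r ^ 2) ^ (a * (N - a)) ≤ N * r ^ N := by
  have hchoose : (N.choose a : ℝ) ≤ (N : ℝ) ^ a := by
    exact_mod_cast Nat.choose_le_pow N a
  have hexp : N * a ≤ 2 * (a * (N - a)) := by
    have h : N ≤ 2 * (N - a) := by omega
    nlinarith [Nat.mul_le_mul_left a h]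
  calc (N.choose a : ℝ) * (r ^ 2) ^ (a * (N - a))
      ≤ (N : ℝ) ^ a * r ^ (N * a) := by
        rw [← pow_mul]
        exact mul_le_mul hchoose (pow_le_pow_of_le_one hr0 hr1 hexp) (by positivity)
          (by positivity)
    _ = (N * r ^ N) ^ a := by rw [mul_pow, pow_mul]
    _ ≤ N * r ^ N := pow_le_of_le_one (by positivity) hN (by omega)

theorem choose_mul_pow_le_of_mem_Icc {r : ℝ} (hr0 : 0 ≤ r) (hr1 : r ≤ 1) {N a : ℕ}
    (hN : (N : ℝ) * r ^ N ≤ 1) (ha : a ∈ Finset.Icc 1 (N - 1)) :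
    (N.choose a : ℝ) * (r ^ 2) ^ (a * (N - a)) ≤ N * r ^ N := by
  rw [Finset.mem_Icc] at ha
  rcases le_total (2 * a) N with h | h
  · exact choose_mul_pow_le hr0 hr1 hN ha.1 h
  · have key := choose_mul_pow_le hr0 hr1 hN (a := N - a) (by omega) (by omega)
    rwa [Nat.choose_symm (by omega), Nat.sub_sub_self (by omega), mul_comm (N - a)] at key

theorem exists_sq_bound_of_isCompact {K : Set ℝ} (hKc : IsCompact K)
    (hK : K ⊆ Set.Ioo (-1 : ℝ) 0) :
    ∃ r : ℝ, 0 ≤ r ∧ r < 1 ∧ ∀ q ∈ K, |q| ≤ r ^ 2 := by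
  rcases K.eq_empty_or_nonempty with rfl | hne
  · exact ⟨0, le_rfl, one_pos, by simp⟩
  · obtain ⟨p, hp, hmin⟩ := hKc.exists_isMinOn hne continuousOn_id
    have hp' := hK hp
    refine ⟨√(-p), Real.sqrt_nonneg _, ?_, fun q hq => ?_⟩
    · rw [Real.sqrt_lt' one_pos]
      linarith [hp'.1]
    · rw [Real.sq_sqrt (by linarith [hp'.2]), abs_of_neg (hK hq).2]
      have : p ≤ q := hmin hq
      linarith

/-- Kernel lemma: if `K ⊂ (-1, 0)` is compact and the functions `b_{N,a}` are uniformly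
bounded on `K`, then `sup_{q ∈ K} |∑_{a=1}^{N-1} C(N,a) b_{N,a}(q) q^{a(N-a)+s}| → 0`
as `N → ∞`. -/
theorem kernel_lemma (K : Set ℝ) (hKc : IsCompact K) (hK : K ⊆ Set.Ioo (-1 : ℝ) 0)
    (s : ℤ) (b : ℕ → ℕ → ℝ → ℝ) (B : ℝ)
    (hb : ∀ N, 2 ≤ N → ∀ a, 1 ≤ a → a ≤ N - 1 → ∀ q ∈ K, |b N a q| ≤ B) :
    Tendsto
      (fun N : ℕ => ⨆ q ∈ K,
        |∑ a ∈ Finset.Icc 1 (N - 1),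
            (N.choose a : ℝ) * b N a q * q ^ (((a * (N - a) : ℕ) : ℤ) + s)|)
      atTop (nhds 0) := by
  obtain ⟨r, hr0, hr1, hr⟩ := exists_sq_bound_of_isCompact hKc hK
  have hcont : ContinuousOn (fun q : ℝ => q ^ s) K := fun q hq =>
    (continuousAt_zpow₀ q s (Or.inl (hK hq).2.ne)).continuousWithinAt
  obtain ⟨M, hM⟩ := hKc.exists_bound_of_continuousOn hcont
  have hlim1 : Tendsto (fun N : ℕ => (N : ℝ) * r ^ N) atTop (nhds 0) :=
    tendsto_self_mul_const_pow_of_lt_one hr0 hr1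
  have hlim2 : Tendsto (fun N : ℕ => (N : ℝ) ^ 2 * r ^ N * (|B| * |M|)) atTop (nhds 0) := by
    simpa using (tendsto_pow_const_mul_const_pow_of_lt_one 2 hr0 hr1).mul_const (|B| * |M|)
  refine squeeze_zero' (Eventually.of_forall fun N =>
    Real.iSup_nonneg fun q => Real.iSup_nonneg fun _ => abs_nonneg _) ?_ hlim2
  filter_upwards [hlim1.eventually_le_const one_pos, eventually_ge_atTop 2] with N hN hN2
  refine Real.iSup_le (fun q => Real.iSup_le (fun hq => ?_) (by positivity)) (by positivity)
  have hterm : ∀ a ∈ Finset.Icc 1 (N - 1),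
      |(N.choose a : ℝ) * b N a q * q ^ (((a * (N - a) : ℕ) : ℤ) + s)|
        ≤ N * r ^ N * (|B| * |M|) := by
    intro a ha
    have hbB : |b N a q| ≤ |B| :=
      (hb N hN2 a (Finset.mem_Icc.1 ha).1 (Finset.mem_Icc.1 ha).2 q hq).trans (le_abs_self B)
    have hqM : |q ^ s| ≤ |M| := (hM q hq).trans (le_abs_self M)
    have hpow : |q| ^ (a * (N - a)) ≤ (r ^ 2) ^ (a * (N - a)) :=
      pow_le_pow_left₀ (abs_nonneg q) (hr q hq) _
    rw [zpow_add₀ (hK hq).2.ne, zpow_natCast, abs_mul, abs_mul, abs_mul, abs_pow, Nat.abs_cast]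
    calc (N.choose a : ℝ) * |b N a q| * (|q| ^ (a * (N - a)) * |q ^ s|)
        = (N.choose a * |q| ^ (a * (N - a))) * (|b N a q| * |q ^ s|) := by ring
      _ ≤ (N.choose a * (r ^ 2) ^ (a * (N - a))) * (|B| * |M|) := by gcongr
      _ ≤ N * r ^ N * (|B| * |M|) := by
        gcongr ?_ * _
        exact choose_mul_pow_le_of_mem_Icc hr0 hr1.le hN ha
  calc _ ≤ ∑ a ∈ Finset.Icc 1 (N - 1), (N : ℝ) * r ^ N * (|B| * |M|) :=
        (Finset.abs_sum_le_sum_abs _ _).trans (Finset.sum_le_sum hterm)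
    _ = ((N - 1 : ℕ) : ℝ) * (N * r ^ N * (|B| * |M|)) := by simp
    _ ≤ N * (N * r ^ N * (|B| * |M|)) := by
        gcongr
        exact Nat.sub_le N 1
    _ = (N : ℝ) ^ 2 * r ^ N * (|B| * |M|) := by ring
end
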